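/- Let Γ be a finitely generated group and M an abelian normal subgroup of Γ such that the quotient Γ/M is abelian. Then there exists a finite subset S of M such that M equals the normal closure of S in Γ, i.e. M is the smallest normal subgroup of Γ containing S. (Equivalently, M is finitely generated as a module over the subring of its endomorphism ring generated by the conjugation action of Γ/M.) -/

import Mathlib

open Pointwise

/-- Two elements of a monoid are *positively independent* if the monoid homomorphism from the
free monoid on two generators sending the generators to them is injective. -/
def PosIndep {G : Type*} [Monoid G] (x y : G) : Prop :=
  Function.Injective
    ((FreeMonoid.lift (fun b : Bool => if b then x else y)) : FreeMonoid Bool →* G)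

/-- A group is virtually nilpotent if it has a nilpotent subgroup of finite index. -/
def VirtuallyNilpotent (G : Type*) [Group G] : Prop :=
  ∃ H : Subgroup G, H.FiniteIndex ∧ Group.IsNilpotent H

/-- A group is metabelian if its commutator subgroup is abelian. -/
def Metabelian (G : Type*) [Group G] : Prop :=
  ∀ a b : commutator G, a * b = b * a

/-- A group is polycyclic iff it is solvable and all its subgroups are finitely generated. -/
def Polycyclic (G : Type*) [Group G] : Prop :=
  IsSolvable G ∧ ∀ H : Subgroup G, Group.FG H

/-- The affine group of the `K`-line: pairs `(a, b)` with `a ∈ Kˣ`, `b ∈ K`,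
acting as `z ↦ a * z + b`. -/
@[ext]
structure Aff (K : Type*) [Field K] where
  a : Kˣ
  b : K

namespace Aff

variable {K : Type*} [Field K]

instance : One (Aff K) := ⟨⟨1, 0⟩⟩
instance : Mul (Aff K) := ⟨fun f g => ⟨f.a * g.a, (f.a : K) * g.b + f.b⟩⟩
instance : Inv (Aff K) := ⟨fun f => ⟨f.a⁻¹, -((↑f.a⁻¹ : K) * f.b)⟩⟩

@[simp] theorem one_a : (1 : Aff K).a = 1 := rfl
@[simp] theorem one_b : (1 : Aff K).b = 0 := rfl
@[simp] theorem mul_a (f g : Aff K) : (f * g).a = f.a * g.a := rfl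
@[simp] theorem mul_b (f g : Aff K) : (f * g).b = (f.a : K) * g.b + f.b := rfl
@[simp] theorem inv_a (f : Aff K) : f⁻¹.a = f.a⁻¹ := rfl
@[simp] theorem inv_b (f : Aff K) : f⁻¹.b = -((↑f.a⁻¹ : K) * f.b) := rfl

instance : Group (Aff K) where
  mul_assoc f g h := by
    ext
    · simp [mul_assoc]
    · simp only [mul_a, mul_b, Units.val_mul]; ring
  one_mul f := by ext <;> simp
  mul_one f := by ext <;> simp
  inv_mul_cancel f := by
    ext
    · simp
    · simp

/-- The canonical projection of the affine group onto `Kˣ`, sending `z ↦ a z + b` to `a`. -/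
def proj : Aff K →* Kˣ where
  toFun f := f.a
  map_one' := rfl
  map_mul' _ _ := rfl

end Aff

/-- The Fitting subgroup: the join of all nilpotent normal subgroups. -/
def FittingSubgroup (G : Type*) [Group G] : Subgroup G :=
  ⨆ (N : Subgroup G) (_ : N.Normal ∧ Group.IsNilpotent N), N

/-- A subgroup of a finitely generated commutative group is finitely generated. -/
theorem Subgroup.fg_of_commGroup {A : Type*} [CommGroup A] [Group.FG A] (K : Subgroup A) :
    K.FG := by
  have : Module.Finite ℤ (Additive A) := Module.Finite.iff_addGroup_fg.mpr inferInstance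
  rw [Subgroup.fg_iff_add_fg, ← AddSubgroup.toIntSubmodule_toAddSubgroup K.toAddSubgroup,
    ← Submodule.fg_iff_addSubgroup_fg]
  exact IsNoetherian.noetherian _

/-- A group generated by pairwise commuting elements is commutative. -/
theorem Subgroup.mul_comm_of_closure_eq_top {G : Type*} [Group G] {T : Set G}
    (hT : Subgroup.closure T = ⊤) (hcomm : ∀ x ∈ T, ∀ y ∈ T, x * y = y * x) (a b : G) :
    a * b = b * a := by
  have := Subgroup.isMulCommutative_closure hcomm
  exact setLike_mul_comm (s := Subgroup.closure T) (hT ▸ Subgroup.mem_top a)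
    (hT ▸ Subgroup.mem_top b)

open scoped commutatorElement in
/-- A normal subgroup of a finitely generated group with commutative quotient is the normal
closure of a finite set. -/
theorem Subgroup.isFinitelyNormallyGenerated_of_commutator_le {G : Type*} [Group G] [Group.FG G]
    (M : Subgroup G) [M.Normal] (hM : _root_.commutator G ≤ M) : M.IsFinitelyNormallyGenerated := by
  obtain ⟨T, hT, hTfin⟩ := Group.fg_iff.mp ‹Group.FG G›
  let C : Set G := Set.image2 (fun x y => ⁅x, y⁆) T T
  let N := Subgroup.normalClosure C
  have hNM : N ≤ M := by
    refine Subgroup.normalClosure_le_normal ?_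
    rintro _ ⟨x, -, y, -, rfl⟩
    exact hM (Subgroup.commutator_mem_commutator (Subgroup.mem_top x) (Subgroup.mem_top y))
  have hsurj : Function.Surjective (QuotientGroup.mk' N) := QuotientGroup.mk'_surjective N
  have htop : Subgroup.closure (QuotientGroup.mk' N '' T) = ⊤ := by
    rw [← MonoidHom.map_closure, hT, Subgroup.map_top_of_surjective _ hsurj]
  have hcomm : ∀ a b : G ⧸ N, a * b = b * a := by
    refine Subgroup.mul_comm_of_closure_eq_top htop ?_
    rintro _ ⟨x, hx, rfl⟩ _ ⟨y, hy, rfl⟩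
    rw [← commutatorElement_eq_one_iff_mul_comm, ← map_commutatorElement]
    exact (QuotientGroup.eq_one_iff _).mpr
      (Subgroup.subset_normalClosure (Set.mem_image2_of_mem hx hy))
  let _ : CommGroup (G ⧸ N) := { (inferInstance : Group (G ⧸ N)) with mul_comm := hcomm }
  have hnormal : (M.map (QuotientGroup.mk' N)).Normal := Subgroup.Normal.map ‹_› _ hsurj
  have hfg : Group.FG (M.map (QuotientGroup.mk' N)) :=
    (Group.fg_iff_subgroup_fg _).mpr (Subgroup.fg_of_commGroup _)
  have hker : (QuotientGroup.mk' N).ker.IsFinitelyNormallyGenerated :=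
    ⟨C, hTfin.image2 _ hTfin, (QuotientGroup.ker_mk' N).symm⟩
  have hcomap := (Subgroup.IsFinitelyNormallyGenerated.of_FG
    (M.map (QuotientGroup.mk' N))).comap hsurj hker
  rwa [Subgroup.comap_map_eq_self (by rwa [QuotientGroup.ker_mk'])] at hcomap

/-- If `Γ` is finitely generated and `M ⊴ Γ` with both `M` and `Γ/M` abelian,
then `M` is the normal closure in `Γ` of a finite subset of `M`. -/
theorem stmt_18 (Γ : Type*) [Group Γ] [Group.FG Γ] (M : Subgroup Γ) (hnorm : M.Normal)
    (habM : ∀ a b : M, a * b = b * a)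
    (habQ : ∀ a b : Γ, a * b * a⁻¹ * b⁻¹ ∈ M) :
    ∃ S : Finset Γ, (S : Set Γ) ⊆ M ∧ Subgroup.normalClosure (S : Set Γ) = M := by
  have hle : commutator Γ ≤ M :=
    Subgroup.commutator_le.mpr fun a _ b _ => habQ a b
  obtain ⟨S, hS, rfl⟩ := M.isFinitelyNormallyGenerated_of_commutator_le hle
  refine ⟨hS.toFinset, ?_, ?_⟩ <;> rw [hS.coe_toFinset]
  exact Subgroup.subset_normalClosure
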